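/- arXiv:math/0203185 — 7 statements merged into one kernel-verified Lean document; each statement's English description precedes it below -/
import Mathlib

section
/- Let A, α, L be as in the standing hypotheses. For each natural number n, the map E_n := α^n ∘ L^n is a conditional expectation from A onto the range of α^n; that is, E_n is a positive linear map with E_n(1) = 1 whose range is contained in α^n(A), which satisfies E_n(a · α^n(c)) = E_n(a) · α^n(c) for all a, c ∈ A, restricts to the identity on α^n(A) (so that E_n ∘ E_n = E_n). -/
/-- The transfer identity `L (a * α b) = L a * b` passes to iterates. -/
theorem iterate_mul_iterate_of_transfer {M : Type*} [Mul M] {α L : M → M}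
    (h : ∀ a b, L (a * α b) = L a * b) (n : ℕ) (a b : M) :
    L^[n] (a * α^[n] b) = L^[n] a * b := by
  induction n generalizing a b with
  | zero => rfl
  | succ n ih =>
    rw [Function.iterate_succ_apply' α, Function.iterate_succ_apply L, h, ih,
      ← Function.iterate_succ_apply L]

/-- Iterates of a self-map that preserves nonnegativity preserve nonnegativity. -/
theorem iterate_nonneg_of_nonneg {M : Type*} [Zero M] [LE M] {f : M → M}
    (h : ∀ a, 0 ≤ a → 0 ≤ f a) (n : ℕ) {a : M} (ha : 0 ≤ a) : 0 ≤ f^[n] a := by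
  induction n with
  | zero => exact ha
  | succ n ih =>
    rw [Function.iterate_succ_apply']
    exact h _ ih


/-- Under the standing hypotheses (A a unital C*-algebra, α an injective
unital *-endomorphism, L a normalized transfer operator), for each n ∈ ℕ the map
E_n := α^n ∘ L^n is a conditional expectation from A onto the range of α^n. -/
theorem stmt_0
    {A : Type*} [NormedRing A] [StarRing A] [CStarRing A]
    [NormedAlgebra ℂ A] [StarModule ℂ A] [CompleteSpace A]
    [PartialOrder A] [StarOrderedRing A]
    (α : A →⋆ₐ[ℂ] A) (hα_inj : Function.Injective α)
    (L : A →L[ℂ] A)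
    (hL_pos : ∀ a : A, 0 ≤ a → 0 ≤ L a)
    (hL_one : L 1 = 1)
    (hL_transfer : ∀ a b : A, L (a * α b) = L a * b) :
    ∀ n : ℕ,
      (∀ a : A, 0 ≤ a → 0 ≤ (⇑α)^[n] ((⇑L)^[n] a)) ∧
      ((⇑α)^[n] ((⇑L)^[n] (1 : A)) = 1) ∧
      (∀ a : A, (⇑α)^[n] ((⇑L)^[n] a) ∈ Set.range ((⇑α)^[n])) ∧
      (∀ a c : A,
        (⇑α)^[n] ((⇑L)^[n] (a * (⇑α)^[n] c)) = (⇑α)^[n] ((⇑L)^[n] a) * (⇑α)^[n] c) ∧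
      (∀ c : A, (⇑α)^[n] ((⇑L)^[n] ((⇑α)^[n] c)) = (⇑α)^[n] c) ∧
      (∀ a : A, (⇑α)^[n] ((⇑L)^[n] ((⇑α)^[n] ((⇑L)^[n] a))) = (⇑α)^[n] ((⇑L)^[n] a)) := by
  intro n
  have hL_one_iterate : (⇑L)^[n] 1 = 1 := Function.iterate_fixed hL_one n
  have hL_section (c : A) : (⇑L)^[n] ((⇑α)^[n] c) = c := by
    simpa [hL_one_iterate] using iterate_mul_iterate_of_transfer hL_transfer n 1 c
  refine ⟨fun a ha ↦ ?_, ?_, fun a ↦ Set.mem_range_self _, fun a c ↦ ?_, fun c ↦ ?_, fun a ↦ ?_⟩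
  · exact iterate_nonneg_of_nonneg (fun _ ↦ map_nonneg α) n (iterate_nonneg_of_nonneg hL_pos n ha)
  · rw [hL_one_iterate, iterate_map_one]
  · rw [iterate_mul_iterate_of_transfer hL_transfer, iterate_map_mul]
  · rw [hL_section]
  · rw [hL_section]
end

section
/- Let X be a compact Hausdorff space and T : X → X a surjective covering map. Then for every continuous function f : X → ℂ, the function 𝓛(f) defined by 𝓛(f)(x) = ∑_{t ∈ T⁻¹(x)} f(t) (a finite sum, since the fibers of T are finite) is continuous on X. -/
/-- The sum of a continuous function over the fibers of a covering map with compact total space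
depends continuously on the base point. -/
theorem IsCoveringMap.continuous_finsum_mem_preimage_singleton
    {E X M : Type*} [TopologicalSpace E] [CompactSpace E] [TopologicalSpace X] [T1Space X]
    [AddCommMonoid M] [TopologicalSpace M] [ContinuousAdd M]
    {p : E → X} (hp : IsCoveringMap p) {f : E → M} (hf : Continuous f) :
    Continuous (fun x : X => ∑ᶠ t ∈ p ⁻¹' {x}, f t) := by
  refine continuous_iff_continuousAt.mpr fun x => ?_
  obtain ⟨hdisc, U, hxU, hU, -, H, hH⟩ := hp x
  have : CompactSpace (p ⁻¹' {x}) :=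
    isCompact_iff_compactSpace.mp (isClosed_singleton.preimage hp.continuous).isCompact
  have : Finite (p ⁻¹' {x}) := finite_of_compact_of_discrete
  have := Fintype.ofFinite (p ⁻¹' {x})
  refine ContinuousOn.continuousAt ?_ (hU.mem_nhds hxU)
  rw [continuousOn_iff_continuous_domRestrict]
  have key : U.domRestrict (fun x : X => ∑ᶠ t ∈ p ⁻¹' {x}, f t) =
      fun y : U => ∑ i : p ⁻¹' {x}, f (H.symm (y, i)) := by
    funext y
    have hrange : p ⁻¹' {y.1} = Set.range fun i => (H.symm (y, i) : E) := by
      ext e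
      simp only [Set.mem_preimage, Set.mem_singleton_iff, Set.mem_range]
      constructor
      · intro he
        have heU : p e ∈ U := he ▸ y.2
        refine ⟨(H ⟨e, heU⟩).2, ?_⟩
        have hy : y = (H ⟨e, heU⟩).1 := Subtype.ext (he.symm.trans (hH ⟨e, heU⟩).symm)
        rw [hy, Prod.mk.eta, H.symm_apply_apply]
      · rintro ⟨i, rfl⟩
        rw [← hH, H.apply_symm_apply]
    have hinj : Function.Injective fun i => (H.symm (y, i) : E) :=
      Subtype.val_injective.comp (H.symm.injective.comp (Prod.mk_right_injective y))
    change ∑ᶠ t ∈ p ⁻¹' {y.1}, f t = _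
    rw [hrange, finsum_mem_range hinj, finsum_eq_sum_of_fintype]
  rw [key]
  fun_prop


/-- If T is a surjective covering map of a compact Hausdorff space X, then
for every continuous f : X → ℂ the function x ↦ ∑_{t ∈ T⁻¹(x)} f(t) (a finite sum,
since the fibers are finite) is continuous on X. -/
theorem stmt_5
    {X : Type*} [TopologicalSpace X] [CompactSpace X] [T2Space X]
    (T : X → X) (hT : IsCoveringMap T) (hTsurj : Function.Surjective T)
    (f : X → ℂ) (hf : Continuous f) :
    Continuous (fun x : X => ∑ᶠ t ∈ T ⁻¹' {x}, f t) :=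
  hT.continuous_finsum_mem_preimage_singleton hf
end

section
/- Let X be a compact Hausdorff space and T : X → X a surjective covering map, and define L on continuous functions by L(f)(x) = (#T⁻¹(x))⁻¹ · ∑_{t ∈ T⁻¹(x)} f(t). Then L is a normalized transfer operator for the endomorphism α(f) = f ∘ T of C(X): for all continuous f, g : X → ℂ and all x ∈ X one has L(f · (g∘T))(x) = L(f)(x) · g(x); L(1) = 1; and if f ≥ 0 pointwise then L(f) ≥ 0 pointwise. -/
open scoped ComplexOrder

/-- A covering map from a compact space to a T₁ space has finite fibers. -/
theorem IsCoveringMap.finite_preimage_singleton {E X : Type*} [TopologicalSpace E]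
    [CompactSpace E] [TopologicalSpace X] [T1Space X] {p : E → X} (hp : IsCoveringMap p) (x : X) :
    (p ⁻¹' {x}).Finite :=
  (isClosed_singleton.preimage hp.continuous).isCompact.finite ⟨(hp x).discreteTopology_fiber⟩

/-- Functions pulled back from the base factor out of sums over a fiber. -/
theorem finsum_mem_preimage_singleton_mul_comp {E X R : Type*} [NonUnitalNonAssocSemiring R]
    {p : E → X} {x : X} (h : (p ⁻¹' {x}).Finite) (f : E → R) (g : X → R) :
    ∑ᶠ t ∈ p ⁻¹' {x}, f t * g (p t) = (∑ᶠ t ∈ p ⁻¹' {x}, f t) * g x := by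
  rw [finsum_mem_eq_finite_toFinset_sum _ h, finsum_mem_eq_finite_toFinset_sum _ h,
    Finset.sum_mul]
  refine Finset.sum_congr rfl fun t ht => ?_
  rw [show p t = x from h.mem_toFinset.1 ht]

/-- For a surjective covering map T of a compact Hausdorff space X, the
averaging operator L(f)(x) = (#T⁻¹(x))⁻¹ · ∑_{t ∈ T⁻¹(x)} f(t) is a normalized transfer
operator for α(f) = f ∘ T:  L(f·(g∘T)) = L(f)·g, L(1) = 1, and L is positive. -/
theorem stmt_8
    {X : Type*} [TopologicalSpace X] [CompactSpace X] [T2Space X]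
    (T : X → X) (hT : IsCoveringMap T) (hTsurj : Function.Surjective T) :
    (∀ f g : X → ℂ, Continuous f → Continuous g → ∀ x : X,
      (Nat.card (T ⁻¹' {x}) : ℂ)⁻¹ * ∑ᶠ t ∈ T ⁻¹' {x}, (f t * g (T t))
        = ((Nat.card (T ⁻¹' {x}) : ℂ)⁻¹ * ∑ᶠ t ∈ T ⁻¹' {x}, f t) * g x) ∧
    (∀ x : X, (Nat.card (T ⁻¹' {x}) : ℂ)⁻¹ * ∑ᶠ t ∈ T ⁻¹' {x}, (1 : ℂ) = 1) ∧
    (∀ f : X → ℂ, Continuous f → (∀ x : X, 0 ≤ f x) →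
      ∀ x : X, 0 ≤ (Nat.card (T ⁻¹' {x}) : ℂ)⁻¹ * ∑ᶠ t ∈ T ⁻¹' {x}, f t) := by
  have hfin (x : X) := hT.finite_preimage_singleton x
  refine ⟨fun f g _ _ x => ?_, fun x => ?_, fun f _ hf x => ?_⟩
  · rw [finsum_mem_preimage_singleton_mul_comp (hfin x), mul_assoc]
  · have : Nonempty (T ⁻¹' {x}) := (hTsurj x).elim fun t ht => ⟨⟨t, ht⟩⟩
    have : Finite (T ⁻¹' {x}) := hfin x
    rw [finsum_mem_eq_finite_toFinset_sum _ (hfin x), Finset.sum_const, nsmul_one,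
      ← Nat.card_eq_card_finite_toFinset]
    exact inv_mul_cancel₀ (Nat.cast_ne_zero.2 Nat.card_pos.ne')
  · exact mul_nonneg (inv_nonneg.2 (Nat.cast_nonneg _))
      (finsum_mem_induction (0 ≤ ·) le_rfl (fun _ _ => add_nonneg) fun t _ => hf t)
end

section
/- Let X be a compact Hausdorff space, T : X → X a surjective covering map, and Λ(x) := #{t ∈ X : T(t) = T(x)} (a finite number). Let V_1, …, V_m be a finite open cover of X such that the restriction of T to each V_i is injective, and let v_1, …, v_m be a partition of unity subordinate to this cover (continuous functions with 0 ≤ v_i ≤ 1, ∑_{i=1}^m v_i = 1, and the support of v_i contained in V_i). Set u_i(x) := √(Λ(x) · v_i(x)). Then for every continuous function f : X → ℂ and every x ∈ X, ∑_{i=1}^m u_i(x) · Λ(x)⁻¹ · ∑_{t : T(t) = T(x)} u_i(t) f(t) = f(x); that is, {u_1, …, u_m} is a quasi-basis for the conditional expectation E(f)(x) = Λ(x)⁻¹ ∑_{T(t)=T(x)} f(t), meaning ∑_{i=1}^m u_i · E(u_i · f) = f. -/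
/-- If finitely many sets on which `T` is injective cover `X`, the fibers of `T` are finite. -/
theorem Set.finite_fiber_of_injOn_cover {X Y ι : Type*} [Finite ι] {T : X → Y} {V : ι → Set X}
    (hcover : ∀ x, ∃ i, x ∈ V i) (hinj : ∀ i, Set.InjOn T (V i)) (y : Y) :
    {t : X | T t = y}.Finite := by
  choose c hc using hcover
  refine Set.Finite.of_injOn (f := c) (t := Set.univ) (fun _ _ => Set.mem_univ _) ?_ Set.finite_univ
  intro a ha b hb hab
  have hb' := hc b
  rw [← hab] at hb'
  exact hinj _ (hc a) hb' (Eq.trans ha (Eq.symm hb))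

/-- A function supported in a set where `T` is injective has a single possibly nonzero value on
each fiber of `T` meeting its support. -/
theorem Set.InjOn.mul_finsum_fiber_mul {X Y R : Type*} [NonUnitalSemiring R] {T : X → Y}
    {V : Set X} (hinj : Set.InjOn T V) {w : X → R} (hw : Function.support w ⊆ V) (g : X → R)
    (x : X) : w x * ∑ᶠ t ∈ {t : X | T t = T x}, w t * g t = w x * (w x * g x) := by
  by_cases hx : w x = 0
  · simp [hx]
  congr 1
  rw [finsum_eq_single _ x]
  · simp
  intro t ht
  by_cases hTt : T t = T x
  · have hwt : w t = 0 := by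
      by_contra h
      exact ht (hinj (hw h) (hw hx) hTt)
    simp [hwt]
  · simp [hTt]

/-- Let T be a surjective covering map of a compact Hausdorff space X,
Λ(x) = #{t : T(t) = T(x)}, {V_i} a finite open cover on whose members T is injective,
{v_i} a subordinate partition of unity, and u_i = √(Λ·v_i).  Then
∑_i u_i · E(u_i·f) = f, where E(f)(x) = Λ(x)⁻¹ ∑_{T(t)=T(x)} f(t); that is,
{u_1,…,u_m} is a quasi-basis for E. -/
theorem stmt_9
    {X : Type*} [TopologicalSpace X] [CompactSpace X] [T2Space X]
    (T : X → X) (hT : IsCoveringMap T) (hTsurj : Function.Surjective T)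
    (m : ℕ) (V : Fin m → Set X)
    (hVopen : ∀ i, IsOpen (V i))
    (hVcover : ∀ x : X, ∃ i, x ∈ V i)
    (hVinj : ∀ i, Set.InjOn T (V i))
    (v : Fin m → X → ℝ)
    (hvcont : ∀ i, Continuous (v i))
    (hv0 : ∀ i x, 0 ≤ v i x) (hv1 : ∀ i x, v i x ≤ 1)
    (hvsum : ∀ x : X, ∑ i, v i x = 1)
    (hvsupp : ∀ i, tsupport (v i) ⊆ V i)
    (u : Fin m → X → ℝ)
    (hu : ∀ i x, u i x = Real.sqrt ((Nat.card {t : X | T t = T x} : ℝ) * v i x))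
    (f : X → ℂ) (hf : Continuous f) (x : X) :
    ∑ i, (u i x : ℂ) *
        ((Nat.card {t : X | T t = T x} : ℂ)⁻¹ *
          ∑ᶠ t ∈ {t : X | T t = T x}, (u i t : ℂ) * f t)
      = f x := by
  have hcard : 0 < Nat.card {t : X | T t = T x} := by
    have := (Set.finite_fiber_of_injOn_cover hVcover hVinj (T x)).to_subtype
    have : Nonempty {t : X | T t = T x} := ⟨⟨x, rfl⟩⟩
    exact Nat.card_pos
  have hne : (Nat.card {t : X | T t = T x} : ℂ) ≠ 0 := by exact_mod_cast hcard.ne'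
  have hsupp (i : Fin m) : Function.support (fun t => (u i t : ℂ)) ⊆ V i := by
    intro t ht
    refine hvsupp i (subset_tsupport _ fun hvt => ht ?_)
    simp [hu, hvt]
  have hsq (i : Fin m) :
      (u i x : ℂ) * u i x = (Nat.card {t : X | T t = T x} : ℂ) * v i x := by
    rw [hu, ← Complex.ofReal_mul,
      Real.mul_self_sqrt (mul_nonneg (Nat.cast_nonneg _) (hv0 i x))]
    push_cast
    rfl
  calc
    _ = ∑ i, (v i x : ℂ) * f x := by
      refine Finset.sum_congr rfl fun i _ => ?_
      rw [mul_left_comm, (hVinj i).mul_finsum_fiber_mul (hsupp i) f x, ← mul_assoc (u i x : ℂ),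
        hsq, mul_assoc, inv_mul_cancel_left₀ hne]
    _ = f x := by
      rw [← Finset.sum_mul, ← Complex.ofReal_sum, hvsum, Complex.ofReal_one, one_mul]
end

section
/- Let X be a compact Hausdorff space, T : X → X a continuous map, n, m natural numbers, and x₀ ∈ X a point such that T^n(x₀) ≠ T^m(x₀) (where T^k denotes the k-fold iterate). Then there exists a continuous function h : X → ℝ such that: (i) 0 ≤ h(x) ≤ 1 for all x ∈ X; (ii) h(x₀) = 1; and (iii) h(y) · h(t) = 0 for every pair of points y, t ∈ X with T^m(t) = T^n(y). (Condition (iii) encodes the relation h S^n S^{*m} h = 0 in the crossed product C(X) ⋊_{α,L} ℕ.) -/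
/-- Let X be compact Hausdorff, T : X → X continuous, and x₀ a point with
T^n(x₀) ≠ T^m(x₀).  Then there is a continuous h : X → ℝ with 0 ≤ h ≤ 1, h(x₀) = 1, and
h(y)·h(t) = 0 whenever T^m(t) = T^n(y)  (encoding h S^n S^{*m} h = 0). -/
theorem stmt_13
    {X : Type*} [TopologicalSpace X] [CompactSpace X] [T2Space X]
    (T : X → X) (hT : Continuous T)
    (n m : ℕ) (x₀ : X) (hx₀ : T^[n] x₀ ≠ T^[m] x₀) :
    ∃ h : X → ℝ, Continuous h ∧
      (∀ x : X, 0 ≤ h x ∧ h x ≤ 1) ∧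
      h x₀ = 1 ∧
      (∀ y t : X, T^[m] t = T^[n] y → h y * h t = 0) := by
  obtain ⟨U, V, hU, hV, hxU, hxV, hUV⟩ := t2_separation hx₀
  have hW : IsOpen (T^[n] ⁻¹' U ∩ T^[m] ⁻¹' V) :=
    (hU.preimage (hT.iterate n)).inter (hV.preimage (hT.iterate m))
  obtain ⟨f, hf0, hf1, hf⟩ := exists_continuous_zero_one_of_isClosed hW.isClosed_compl
    (isClosed_singleton (x := x₀))
    (Set.disjoint_singleton_right.mpr fun hx => hx ⟨hxU, hxV⟩)
  refine ⟨f, f.continuous, hf, hf1 rfl, fun y t hyt => ?_⟩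
  by_cases hy : T^[n] y ∈ U
  · have ht : T^[m] t ∉ V := fun ht => Set.disjoint_left.mp hUV hy (hyt ▸ ht)
    have hft : f t = 0 := hf0 fun h => ht h.2
    rw [hft, mul_zero]
  · have hfy : f y = 0 := hf0 fun h => hy h.1
    rw [hfy, zero_mul]
end

section
/- Let X be a compact Hausdorff space and T : X → X a surjective covering map (in particular T is continuous and open). Suppose T is irreducible, i.e. the only closed subsets F ⊆ X with T⁻¹(F) = F are F = ∅ and F = X. Then either: (i) T is topologically free, meaning that for every pair of natural numbers n ≠ m the set {x ∈ X : T^n(x) = T^m(x)} has empty interior; or (ii) X is a finite set and T is a cyclic permutation of X, i.e. T is bijective and for every pair of points x, y ∈ X there is a natural number k with T^k(x) = y. -/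
theorem isOpenMap_iterate {X : Type*} [TopologicalSpace X] {T : X → X} (hopen : IsOpenMap T) :
    ∀ n : ℕ, IsOpenMap T^[n]
  | 0 => IsOpenMap.id
  | n + 1 => (isOpenMap_iterate hopen n).comp hopen

open Function in
/-- For an open continuous surjection of a compact space without nontrivial closed completely
invariant sets, an iterate that fixes some nonempty open set pointwise is the identity. -/
theorem isPeriodicPt_of_interior_ptsOfPeriod_nonempty
    {X : Type*} [TopologicalSpace X] [CompactSpace X] {T : X → X}
    (hcont : Continuous T) (hopen : IsOpenMap T) (hsurj : Surjective T)
    (hirr : ∀ F : Set X, IsClosed F → T ⁻¹' F = F → F = ∅ ∨ F = Set.univ)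
    {p : ℕ} (hne : (interior (ptsOfPeriod T p)).Nonempty) (x : X) : IsPeriodicPt T p x := by
  set W := interior (ptsOfPeriod T p)
  have hWsub : W ⊆ ptsOfPeriod T p := interior_subset
  have hstep : W ⊆ T ⁻¹' W := by
    refine Set.image_subset_iff.1 (interior_maximal ?_ (hopen _ isOpen_interior))
    rintro _ ⟨y, hy, rfl⟩
    exact IsPeriodicPt.apply (hWsub hy)
  have hmono : Monotone fun k : ℕ => T^[k] ⁻¹' W := by
    refine monotone_nat_of_le_succ fun k y hy => ?_
    rw [Set.mem_preimage, iterate_succ_apply']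
    exact hstep hy
  have hOpen (k : ℕ) : IsOpen (T^[k] ⁻¹' W) := isOpen_interior.preimage (hcont.iterate k)
  have hinv : T ⁻¹' (⋃ k : ℕ, T^[k] ⁻¹' W) = ⋃ k : ℕ, T^[k] ⁻¹' W := by
    ext y
    simp only [Set.mem_preimage, Set.mem_iUnion, ← iterate_succ_apply]
    exact ⟨fun ⟨k, hk⟩ => ⟨k + 1, hk⟩, fun ⟨k, hk⟩ => ⟨k, hmono k.le_succ hk⟩⟩
  have huniv : ⋃ k : ℕ, T^[k] ⁻¹' W = Set.univ := by
    rcases hirr (⋃ k : ℕ, T^[k] ⁻¹' W)ᶜ (isOpen_iUnion hOpen).isClosed_compl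
      (by rw [Set.preimage_compl, hinv]) with h | h
    · exact Set.compl_empty_iff.1 h
    · obtain ⟨y, hy⟩ := hne
      exact absurd (Set.mem_iUnion.2 ⟨0, hy⟩) (h ▸ Set.mem_univ y)
  obtain ⟨N, hN⟩ := isCompact_univ.elim_directed_cover _ hOpen huniv.ge hmono.directed_le
  obtain ⟨y, rfl⟩ := hsurj.iterate N x
  exact hWsub (hN (Set.mem_univ y))

open Function in
/-- A self-map of a nonempty T1 space with an iterate equal to the identity and without nontrivial
closed completely invariant sets is a cyclic permutation of a finite set. -/
theorem finite_and_bijective_and_transitive_of_isPeriodicPt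
    {X : Type*} [TopologicalSpace X] [T1Space X] [Nonempty X] {T : X → X}
    (hirr : ∀ F : Set X, IsClosed F → T ⁻¹' F = F → F = ∅ ∨ F = Set.univ)
    {p : ℕ} (hp : 0 < p) (hper : ∀ x, IsPeriodicPt T p x) :
    Finite X ∧ Bijective T ∧ ∀ x y : X, ∃ k : ℕ, T^[k] x = y := by
  have hT (y : X) : T^[p - 1] (T y) = y := by
    rw [← iterate_succ_apply, Nat.succ_eq_add_one, Nat.sub_add_cancel hp]
    exact hper y
  have horbit_finite (x : X) : (Set.range fun k : ℕ => T^[k] x).Finite := by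
    refine ((Set.finite_lt_nat p).image fun k => T^[k] x).subset ?_
    rintro _ ⟨k, rfl⟩
    exact ⟨k % p, Nat.mod_lt _ hp, (hper x).iterate_mod_apply k⟩
  have horbit (x : X) : (Set.range fun k : ℕ => T^[k] x) = Set.univ := by
    refine (hirr _ (horbit_finite x).isClosed ?_).resolve_left (Set.range_nonempty _).ne_empty
    ext y
    constructor
    · rintro ⟨k, hk : T^[k] x = T y⟩
      exact ⟨p - 1 + k, by simp only [iterate_add_apply, hk, hT]⟩
    · rintro ⟨k, rfl⟩
      exact ⟨k + 1, iterate_succ_apply' T k x⟩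
  refine ⟨?_, ⟨LeftInverse.injective hT, fun y => ⟨T^[p - 1] y, ?_⟩⟩, fun x y => ?_⟩
  · obtain ⟨x⟩ := ‹Nonempty X›
    exact Set.finite_univ_iff.1 (horbit x ▸ horbit_finite x)
  · rw [← iterate_succ_apply' T, iterate_succ_apply, hT]
  · exact (horbit x).ge (Set.mem_univ y)

/-- Let T be a surjective covering map of a compact Hausdorff space X which
is irreducible (the only closed sets F with T⁻¹(F) = F are ∅ and X).  Then either T is
topologically free (for all n ≠ m the set {x : T^n(x) = T^m(x)} has empty interior), or
X is finite and T is a cyclic permutation of X. -/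
theorem stmt_15
    {X : Type*} [TopologicalSpace X] [CompactSpace X] [T2Space X]
    (T : X → X) (hT : IsCoveringMap T) (hTsurj : Function.Surjective T)
    (hirr : ∀ F : Set X, IsClosed F → T ⁻¹' F = F → F = ∅ ∨ F = Set.univ) :
    (∀ n m : ℕ, n ≠ m → interior {x : X | T^[n] x = T^[m] x} = ∅) ∨
    (Finite X ∧ Function.Bijective T ∧ ∀ x y : X, ∃ k : ℕ, T^[k] x = y) := by
  rw [or_iff_not_imp_right]
  intro hcyc n m hnm
  wlog hlt : m < n generalizing n m
  · simpa only [eq_comm] using this m n hnm.symm (by lia)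
  by_contra hne
  obtain ⟨x, hx⟩ := Set.nonempty_iff_ne_empty.2 hne
  have : Nonempty X := ⟨x⟩
  refine hcyc (finite_and_bijective_and_transitive_of_isPeriodicPt hirr (Nat.sub_pos_of_lt hlt)
    (isPeriodicPt_of_interior_ptsOfPeriod_nonempty hT.continuous hT.isOpenMap hTsurj hirr
      ⟨T^[m] x, ?_⟩))
  refine interior_maximal ?_ (isOpenMap_iterate hT.isOpenMap m _ isOpen_interior)
    (Set.mem_image_of_mem _ hx)
  rintro _ ⟨y, hy, rfl⟩
  have hnm_eq : T^[n] y = T^[m] y := interior_subset (s := {x | T^[n] x = T^[m] x}) hy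
  change T^[n - m] (T^[m] y) = T^[m] y
  rwa [← Function.iterate_add_apply, Nat.sub_add_cancel hlt.le]
end

section
/- Let X be a compact topological space and T : X → X a continuous, open, surjective map which is irreducible, i.e. the only closed subsets F ⊆ X with T⁻¹(F) = F are F = ∅ and F = X. Suppose T is not topologically free, i.e. there exist natural numbers n ≠ m and a nonempty open set U ⊆ X with T^n(u) = T^m(u) for all u ∈ U. Then there exists a natural number s ≥ 1 such that T^s is the identity map of X (and in particular T is bijective). -/
/-- An open map sends the interior of the fixed-point set of an iterate into itself. -/
theorem mapsTo_interior_fixedPoints_iterate {X : Type*} [TopologicalSpace X] {T : X → X}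
    (hT : IsOpenMap T) (s : ℕ) :
    Set.MapsTo T (interior (Function.fixedPoints T^[s]))
      (interior (Function.fixedPoints T^[s])) := by
  rw [Set.mapsTo_iff_image_subset]
  refine interior_maximal ?_ (hT _ isOpen_interior)
  rintro _ ⟨x, hx, rfl⟩
  have h : x ∈ Function.fixedPoints T^[s] := interior_subset hx
  rw [Function.mem_fixedPoints_iff] at h
  change T^[s] (T x) = T x
  rw [← Function.iterate_succ_apply, Function.iterate_succ_apply', h]

/-- If `T` is irreducible and `W` is a nonempty open set with `T W ⊆ W`, then `W` is everything. -/
theorem eq_univ_of_isOpen_of_mapsTo {X : Type*} [TopologicalSpace X] [CompactSpace X]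
    {T : X → X} (hTcont : Continuous T) (hTsurj : Function.Surjective T)
    (hirr : ∀ F : Set X, IsClosed F → T ⁻¹' F = F → F = ∅ ∨ F = Set.univ)
    {W : Set X} (hW : IsOpen W) (hne : W.Nonempty) (hmaps : Set.MapsTo T W W) :
    W = Set.univ := by
  have hopen (k : ℕ) : IsOpen (T^[k] ⁻¹' W) := hW.preimage (hTcont.iterate k)
  have hmono : Monotone fun k : ℕ => T^[k] ⁻¹' W := by
    refine monotone_nat_of_le_succ fun k x hx => ?_
    change T^[k + 1] x ∈ W
    rw [Function.iterate_succ_apply']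
    exact hmaps hx
  have hinv : T ⁻¹' (⋃ k : ℕ, T^[k] ⁻¹' W) = ⋃ k : ℕ, T^[k] ⁻¹' W := by
    ext x
    simp only [Set.mem_preimage, Set.mem_iUnion]
    constructor
    · rintro ⟨k, hk⟩
      exact ⟨k + 1, hk⟩
    · rintro ⟨k, hk⟩
      exact ⟨k, hmono k.le_succ hk⟩
  have hcover : ⋃ k : ℕ, T^[k] ⁻¹' W = Set.univ := by
    rcases hirr (⋃ k : ℕ, T^[k] ⁻¹' W)ᶜ (isOpen_iUnion hopen).isClosed_compl
      (by rw [Set.preimage_compl, hinv]) with h | h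
    · exact Set.compl_empty_iff.mp h
    · obtain ⟨w, hw⟩ := hne
      exact absurd (Set.mem_iUnion.mpr ⟨0, hw⟩) (h.symm ▸ Set.mem_univ w : w ∈ _ᶜ)
  obtain ⟨k, hk⟩ := isCompact_univ.elim_directed_cover _ hopen hcover.ge hmono.directed_le
  refine Set.eq_univ_of_forall fun x => ?_
  obtain ⟨y, rfl⟩ := hTsurj.iterate k x
  exact hk (Set.mem_univ y)

/-- Let X be a compact space and T : X → X a continuous, open, surjective,
irreducible map.  If T is not topologically free — i.e. there are n ≠ m and a nonempty
open U with T^n = T^m on U — then some positive iterate of T is the identity map. -/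
theorem stmt_16
    {X : Type*} [TopologicalSpace X] [CompactSpace X]
    (T : X → X) (hTcont : Continuous T) (hTopen : IsOpenMap T)
    (hTsurj : Function.Surjective T)
    (hirr : ∀ F : Set X, IsClosed F → T ⁻¹' F = F → F = ∅ ∨ F = Set.univ)
    (n m : ℕ) (hnm : n ≠ m)
    (U : Set X) (hUopen : IsOpen U) (hUne : U.Nonempty)
    (hU : ∀ u ∈ U, T^[n] u = T^[m] u) :
    ∃ s : ℕ, 1 ≤ s ∧ T^[s] = id := by
  wlog hlt : m < n generalizing n m
  · exact this m n hnm.symm (fun u hu => (hU u hu).symm) (by omega)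
  obtain ⟨s, rfl⟩ := Nat.exists_eq_add_of_lt hlt
  have hopen (k : ℕ) : IsOpen (T^[k] '' U) := by
    induction k with
    | zero => simpa using hUopen
    | succ k ih =>
      rw [Function.iterate_succ', Set.image_comp]
      exact hTopen _ ih
  have hfix : T^[m] '' U ⊆ interior (Function.fixedPoints T^[s + 1]) := by
    refine interior_maximal ?_ (hopen m)
    rintro _ ⟨u, hu, rfl⟩
    change T^[s + 1] (T^[m] u) = T^[m] u
    rw [← Function.iterate_add_apply, add_comm, ← add_assoc, hU u hu]
  have huniv := eq_univ_of_isOpen_of_mapsTo hTcont hTsurj hirr isOpen_interior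
    ((hUne.image _).mono hfix) (mapsTo_interior_fixedPoints_iterate hTopen (s + 1))
  refine ⟨s + 1, by omega, funext fun x => ?_⟩
  have hx : x ∈ Function.fixedPoints T^[s + 1] := interior_subset (huniv.ge (Set.mem_univ x))
  exact hx
end
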